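/- Let D ⊆ ℂ be a domain and 𝓕 a family of holomorphic functions on D. If J(𝓕) contains at least two points and the Fatou like set F(𝓕) is forward invariant under 𝓕, then J(𝓕) is a perfect set (i.e., J(𝓕) is closed in D and has no isolated points). -/

import Mathlib

open Filter Topology

/-- A sequence of complex functions tends to `∞` locally uniformly on `U`:
on every compact subset of `U` the moduli eventually exceed any bound,
uniformly. -/
def TendstoInftyLocallyUniformlyOn (F : ℕ → ℂ → ℂ) (U : Set ℂ) : Prop :=
  ∀ M : ℝ, ∀ K ⊆ U, IsCompact K → ∀ᶠ n in atTop, ∀ z ∈ K, M ≤ ‖F n z‖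

/-- The family `𝓕` is normal at the point `z₀` of the domain `D`: there is a
neighborhood `U ⊆ D` of `z₀` on which every sequence in `𝓕` has a subsequence
converging locally uniformly either to a holomorphic function or to `∞`. -/
def IsNormalAt (𝓕 : Set (ℂ → ℂ)) (D : Set ℂ) (z₀ : ℂ) : Prop :=
  ∃ U : Set ℂ, IsOpen U ∧ z₀ ∈ U ∧ U ⊆ D ∧
    ∀ f : ℕ → ℂ → ℂ, (∀ n, f n ∈ 𝓕) →
      ∃ φ : ℕ → ℕ, StrictMono φ ∧
        ((∃ g : ℂ → ℂ, DifferentiableOn ℂ g U ∧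
            TendstoLocallyUniformlyOn (fun n => f (φ n)) g atTop U) ∨
          TendstoInftyLocallyUniformlyOn (fun n => f (φ n)) U)

/-- The Fatou like set of the family `𝓕` on the domain `D`. -/
def fatouLike (𝓕 : Set (ℂ → ℂ)) (D : Set ℂ) : Set ℂ :=
  {z ∈ D | IsNormalAt 𝓕 D z}

/-- The Julia like set of the family `𝓕` on the domain `D`. -/
def juliaLike (𝓕 : Set (ℂ → ℂ)) (D : Set ℂ) : Set ℂ :=
  D \ fatouLike 𝓕 D

/-- Normality propagates from a point to a whole neighborhood of it. -/
theorem isOpen_fatouLike (𝓕 : Set (ℂ → ℂ)) (D : Set ℂ) : IsOpen (fatouLike 𝓕 D) := by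
  rw [isOpen_iff_mem_nhds]
  rintro z ⟨_, U, hU, hzU, hUD, h⟩
  filter_upwards [hU.mem_nhds hzU] with w hw
  exact ⟨hUD hw, U, hU, hw, hUD, h⟩

/-- The sequence `f` tends to `∞` uniformly on `V`. -/
def TendstoInftyUniformlyOn (f : ℕ → ℂ → ℂ) (V : Set ℂ) : Prop :=
  ∀ M : ℝ, ∀ᶠ n in atTop, ∀ z ∈ V, M ≤ ‖f n z‖

theorem TendstoInftyUniformlyOn.mono {f : ℕ → ℂ → ℂ} {V W : Set ℂ}
    (h : TendstoInftyUniformlyOn f V) (hWV : W ⊆ V) : TendstoInftyUniformlyOn f W :=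
  fun M => (h M).mono fun _ hn z hz => hn z (hWV hz)

theorem UniformCauchySeqOn.union {f : ℕ → ℂ → ℂ} {V W : Set ℂ}
    (hV : UniformCauchySeqOn f atTop V) (hW : UniformCauchySeqOn f atTop W) :
    UniformCauchySeqOn f atTop (V ∪ W) := by
  intro u hu
  filter_upwards [hV u hu, hW u hu] with n h1 h2 z hz
  exact hz.elim (h1 z) (h2 z)

theorem TendstoInftyUniformlyOn.comp {f : ℕ → ℂ → ℂ} {V : Set ℂ}
    (h : TendstoInftyUniformlyOn f V) {φ : ℕ → ℕ} (hφ : StrictMono φ) :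
    TendstoInftyUniformlyOn (fun n => f (φ n)) V :=
  fun M => hφ.tendsto_atTop.eventually (h M)

theorem UniformCauchySeqOn.comp_strictMono {f : ℕ → ℂ → ℂ} {V : Set ℂ}
    (h : UniformCauchySeqOn f atTop V) {φ : ℕ → ℕ} (hφ : StrictMono φ) :
    UniformCauchySeqOn (fun n => f (φ n)) atTop V := fun u hu =>
  (hφ.tendsto_atTop.prodMap hφ.tendsto_atTop).eventually (h u hu)

/-- A sequence in a family that is normal at every point of a compact set has a subsequence that,
near every point of the compact set, is uniformly Cauchy or tends uniformly to `∞`. -/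
theorem exists_subseq_of_isCompact {𝓕 : Set (ℂ → ℂ)} {D K : Set ℂ} (hK : IsCompact K)
    (hKF : K ⊆ fatouLike 𝓕 D) (f : ℕ → ℂ → ℂ) (hf : ∀ n, f n ∈ 𝓕) :
    ∃ φ : ℕ → ℕ, StrictMono φ ∧ ∀ z ∈ K,
      (∃ V ∈ 𝓝 z, UniformCauchySeqOn (fun n => f (φ n)) atTop V) ∨
        ∃ V ∈ 𝓝 z, TendstoInftyUniformlyOn (fun n => f (φ n)) V := by
  revert f
  refine hK.induction_on (p := fun s => ∀ f : ℕ → ℂ → ℂ, (∀ n, f n ∈ 𝓕) →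
    ∃ φ : ℕ → ℕ, StrictMono φ ∧ ∀ z ∈ s,
      (∃ V ∈ 𝓝 z, UniformCauchySeqOn (fun n => f (φ n)) atTop V) ∨
        ∃ V ∈ 𝓝 z, TendstoInftyUniformlyOn (fun n => f (φ n)) V) ?_ ?_ ?_ ?_
  · exact fun f _ => ⟨id, strictMono_id, by simp⟩
  · intro s t hst ht f hf
    obtain ⟨φ, hφ, h⟩ := ht f hf
    exact ⟨φ, hφ, fun z hz => h z (hst hz)⟩
  · intro s t hs ht f hf
    obtain ⟨φ, hφ, h⟩ := hs f hf
    obtain ⟨ψ, hψ, h'⟩ := ht (fun n => f (φ n)) fun n => hf _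
    refine ⟨φ ∘ ψ, hφ.comp hψ, ?_⟩
    rintro z (hz | hz)
    · rcases h z hz with ⟨V, hV, hc⟩ | ⟨V, hV, hc⟩
      · exact Or.inl ⟨V, hV, hc.comp_strictMono hψ⟩
      · exact Or.inr ⟨V, hV, hc.comp hψ⟩
    · exact h' z hz
  · intro x hx
    obtain ⟨_, U, hU, hxU, _, hn⟩ := hKF hx
    obtain ⟨C, hCx, hCU, hC⟩ := local_compact_nhds (hU.mem_nhds hxU)
    refine ⟨interior C, mem_nhdsWithin_of_mem_nhds (interior_mem_nhds.2 hCx), ?_⟩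
    intro f hf
    obtain ⟨φ, hφ, ⟨g, -, h⟩ | h⟩ := hn f hf
    · have h' := (tendstoLocallyUniformlyOn_iff_forall_isCompact hU).1 h C hCU hC
      exact ⟨φ, hφ, fun z hz =>
        Or.inl ⟨C, mem_interior_iff_mem_nhds.1 hz, h'.uniformCauchySeqOn⟩⟩
    · exact ⟨φ, hφ, fun z hz =>
        Or.inr ⟨C, mem_interior_iff_mem_nhds.1 hz, fun M => h M C hCU hC⟩⟩

/-- On a compact connected set the two alternatives of `exists_subseq_of_isCompact` cannot mix. -/
theorem uniformCauchySeqOn_or_tendstoInftyUniformlyOn {K : Set ℂ} (hK : IsCompact K)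
    (hKc : IsPreconnected K) {f : ℕ → ℂ → ℂ}
    (h : ∀ z ∈ K, (∃ V ∈ 𝓝 z, UniformCauchySeqOn f atTop V) ∨
      ∃ V ∈ 𝓝 z, TendstoInftyUniformlyOn f V) :
    UniformCauchySeqOn f atTop K ∨ TendstoInftyUniformlyOn f K := by
  have hopen (p : Set ℂ → Prop) : IsOpen {z : ℂ | ∃ V ∈ 𝓝 z, p V} := by
    rw [isOpen_iff_mem_nhds]
    rintro z ⟨V, hV, hp⟩
    filter_upwards [eventually_mem_nhds_iff.2 hV] with w hw
    exact ⟨V, hw, hp⟩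
  have hdisj : ∀ z : ℂ, (∃ V ∈ 𝓝 z, UniformCauchySeqOn f atTop V) →
      (∃ V ∈ 𝓝 z, TendstoInftyUniformlyOn f V) → False := by
    rintro z ⟨V, hV, hc⟩ ⟨W, hW, hi⟩
    have hb := (hc.cauchySeq (mem_of_mem_nhds hV)).isBounded_range
    obtain ⟨C, hC⟩ := hb.exists_norm_le
    obtain ⟨n, hn⟩ := (hi (C + 1)).exists
    have h1 := hn z (mem_of_mem_nhds hW)
    have h2 := hC _ (Set.mem_range_self n)
    linarith
  rcases isPreconnected_iff_subset_of_disjoint.1 hKc _ _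
    (hopen fun V => UniformCauchySeqOn f atTop V) (hopen (TendstoInftyUniformlyOn f)) h
    (Set.eq_empty_of_forall_notMem fun z hz => hdisj z hz.2.1 hz.2.2) with h | h
  · refine Or.inl (hK.induction_on (p := fun s => UniformCauchySeqOn f atTop s) ?_ ?_ ?_ ?_)
    · exact fun u _ => by simp
    · exact fun s t hst ht => ht.mono hst
    · exact fun s t hs ht => hs.union ht
    · intro x hx
      obtain ⟨V, hV, hc⟩ := h hx
      exact ⟨V, mem_nhdsWithin_of_mem_nhds hV, hc⟩
  · refine Or.inr (hK.induction_on (p := TendstoInftyUniformlyOn f) ?_ ?_ ?_ ?_)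
    · exact fun M => by simp
    · exact fun s t hst ht => ht.mono hst
    · intro s t hs ht M
      filter_upwards [hs M, ht M] with n h1 h2 z hz
      exact hz.elim (h1 z) (h2 z)
    · intro x hx
      obtain ⟨V, hV, hc⟩ := h hx
      exact ⟨V, mem_nhdsWithin_of_mem_nhds hV, hc⟩

/-- Maximum modulus principle on a disc. -/
theorem norm_le_on_closedBall {g : ℂ → ℂ} {z₀ : ℂ} {r C : ℝ} (hr : 0 < r)
    (hg : DifferentiableOn ℂ g (Metric.closedBall z₀ r))
    (hC : ∀ z ∈ Metric.sphere z₀ r, ‖g z‖ ≤ C) :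
    ∀ z ∈ Metric.closedBall z₀ r, ‖g z‖ ≤ C := by
  intro z hz
  refine Complex.norm_le_of_forall_mem_frontier_norm_le (U := Metric.ball z₀ r)
    Metric.isBounded_ball ?_ ?_ ?_
  · exact hg.diffContOnCl_ball subset_rfl
  · rwa [frontier_ball z₀ hr.ne']
  · rwa [closure_ball z₀ hr.ne']

/-- A sequence of holomorphic functions that is uniformly Cauchy on a circle converges locally
uniformly inside it to a holomorphic function. -/
theorem exists_tendstoLocallyUniformlyOn_ball {f : ℕ → ℂ → ℂ} {z₀ : ℂ} {r : ℝ} (hr : 0 < r)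
    (hf : ∀ n, DifferentiableOn ℂ (f n) (Metric.closedBall z₀ r))
    (h : UniformCauchySeqOn f atTop (Metric.sphere z₀ r)) :
    ∃ g : ℂ → ℂ, DifferentiableOn ℂ g (Metric.ball z₀ r) ∧
      TendstoLocallyUniformlyOn f g atTop (Metric.ball z₀ r) := by
  have hc : UniformCauchySeqOn f atTop (Metric.closedBall z₀ r) := by
    rw [Metric.uniformCauchySeqOn_iff] at h ⊢
    intro ε hε
    obtain ⟨N, hN⟩ := h (ε / 2) (half_pos hε)
    refine ⟨N, fun m hm n hn z hz => ?_⟩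
    have := norm_le_on_closedBall hr ((hf m).sub (hf n)) (C := ε / 2)
      (fun w hw => by simpa [dist_eq_norm] using (hN m hm n hn w hw).le) z hz
    rw [dist_eq_norm]
    simp only [Pi.sub_apply] at this
    linarith
  have hlim : ∀ z, ∃ w, z ∈ Metric.closedBall z₀ r → Tendsto (fun n => f n z) atTop (𝓝 w) := by
    intro z
    by_cases hz : z ∈ Metric.closedBall z₀ r
    · obtain ⟨w, hw⟩ := cauchySeq_tendsto_of_complete (hc.cauchySeq hz)
      exact ⟨w, fun _ => hw⟩
    · exact ⟨0, fun h => absurd h hz⟩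
  choose g hg using hlim
  have ht : TendstoLocallyUniformlyOn f g atTop (Metric.ball z₀ r) :=
    ((hc.tendstoUniformlyOn_of_tendsto hg).mono
      Metric.ball_subset_closedBall).tendstoLocallyUniformlyOn
  exact ⟨g, ht.differentiableOn
    (.of_forall fun n => (hf n).mono Metric.ball_subset_closedBall) Metric.isOpen_ball, ht⟩

/-- If a sequence of holomorphic functions tends to `∞` uniformly on a circle and each of them omits
one of two given values on the closed disc, then it tends to `∞` uniformly on the disc. -/
theorem tendstoInftyUniformlyOn_closedBall {f : ℕ → ℂ → ℂ} {z₀ a b : ℂ} {r : ℝ} (hr : 0 < r)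
    (hf : ∀ n, DifferentiableOn ℂ (f n) (Metric.closedBall z₀ r))
    (homit : ∀ n, (∀ z ∈ Metric.closedBall z₀ r, f n z ≠ a) ∨
      ∀ z ∈ Metric.closedBall z₀ r, f n z ≠ b)
    (h : TendstoInftyUniformlyOn f (Metric.sphere z₀ r)) :
    TendstoInftyUniformlyOn f (Metric.closedBall z₀ r) := by
  intro M
  have key : ∀ n, ∀ c : ℂ, ‖c‖ ≤ ‖a‖ + ‖b‖ →
      (∀ z ∈ Metric.closedBall z₀ r, f n z ≠ c) →
      (∀ z ∈ Metric.sphere z₀ r, |M| + 1 + 2 * (‖a‖ + ‖b‖) ≤ ‖f n z‖) →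
      ∀ z ∈ Metric.closedBall z₀ r, M ≤ ‖f n z‖ := by
    intro n c hc hne hbig z hz
    set L := |M| + 1 + (‖a‖ + ‖b‖) with hL
    have hLpos : 0 < L := by positivity
    have hinv := norm_le_on_closedBall hr (C := L⁻¹)
      (((hf n).sub_const c).inv fun w hw => sub_ne_zero.2 (hne w hw)) (fun w hw => by
        have h1 := hbig w hw
        have h2 := norm_sub_norm_le (f n w) c
        simp only [Pi.inv_apply, norm_inv]
        exact inv_anti₀ hLpos (by linarith)) z hz
    simp only [Pi.inv_apply, norm_inv] at hinv
    have hpos : 0 < ‖f n z - c‖ := norm_pos_iff.2 (sub_ne_zero.2 (hne z hz))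
    have h3 := (inv_le_inv₀ hpos hLpos).1 hinv
    have h4 := norm_sub_le (f n z) c
    have h5 := le_abs_self M
    linarith
  filter_upwards [h (|M| + 1 + 2 * (‖a‖ + ‖b‖))] with n hn
  rcases homit n with ho | ho
  · exact key n a (by linarith [norm_nonneg b]) ho hn
  · exact key n b (by linarith [norm_nonneg a]) ho hn

/-- If the Julia like set of `𝓕` contains at least two points and
the Fatou like set is forward invariant under `𝓕`, then the Julia like set is a
perfect set: closed in `D` and without isolated points. -/
theorem juliaLike_perfect (D : Set ℂ) (hD : IsOpen D) (hDconn : IsConnected D)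
    (𝓕 : Set (ℂ → ℂ)) (hol : ∀ f ∈ 𝓕, DifferentiableOn ℂ f D)
    (hJ : ∃ a b : ℂ, a ≠ b ∧ a ∈ juliaLike 𝓕 D ∧ b ∈ juliaLike 𝓕 D)
    (hFwd : ∀ f ∈ 𝓕, f '' fatouLike 𝓕 D ⊆ fatouLike 𝓕 D) :
    IsClosed (Subtype.val ⁻¹' juliaLike 𝓕 D : Set ↥D) ∧
      ∀ z ∈ juliaLike 𝓕 D, AccPt z (𝓟 (juliaLike 𝓕 D)) := by
  constructor
  · have : (Subtype.val ⁻¹' juliaLike 𝓕 D : Set ↥D) = (Subtype.val ⁻¹' fatouLike 𝓕 D)ᶜ := by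
      ext z
      simp [juliaLike]
    rw [this]
    exact ((isOpen_fatouLike 𝓕 D).preimage continuous_subtype_val).isClosed_compl
  intro z₀ hz₀
  by_contra hacc
  refine hz₀.2 ⟨hz₀.1, ?_⟩
  obtain ⟨a, b, hab, ha, hb⟩ := hJ
  rw [accPt_iff_frequently, not_frequently] at hacc
  obtain ⟨r, hr, hball⟩ := Metric.nhds_basis_closedBall.mem_iff.1
    (inter_mem (hD.mem_nhds hz₀.1) hacc)
  have hballD : Metric.closedBall z₀ r ⊆ D := fun z hz => (hball hz).1
  have hfatou : ∀ z ∈ Metric.closedBall z₀ r, z ≠ z₀ → z ∈ fatouLike 𝓕 D := by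
    intro z hz hne
    by_contra hF
    exact (hball hz).2 ⟨hne, hballD hz, hF⟩
  have homit : ∀ f ∈ 𝓕, (∀ z ∈ Metric.closedBall z₀ r, f z ≠ a) ∨
      ∀ z ∈ Metric.closedBall z₀ r, f z ≠ b := by
    intro f hf
    have hmap (c : ℂ) (hc : c ∈ juliaLike 𝓕 D) (h₀ : f z₀ ≠ c) :
        ∀ z ∈ Metric.closedBall z₀ r, f z ≠ c := by
      intro z hz hzc
      by_cases hne : z = z₀
      · exact h₀ (hne ▸ hzc)
      · exact hc.2 (hzc ▸ hFwd f hf (Set.mem_image_of_mem f (hfatou z hz hne)))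
    by_cases h₀ : f z₀ = a
    · exact Or.inr (hmap b hb (h₀ ▸ hab))
    · exact Or.inl (hmap a ha h₀)
  refine ⟨Metric.ball z₀ r, Metric.isOpen_ball, Metric.mem_ball_self hr,
    Metric.ball_subset_closedBall.trans hballD, fun f hf => ?_⟩
  obtain ⟨φ, hφ, hloc⟩ := exists_subseq_of_isCompact (isCompact_sphere z₀ r)
    (fun z hz => hfatou z (Metric.sphere_subset_closedBall hz)
      (Metric.ne_of_mem_sphere hz hr.ne')) f hf
  have hdiff (n : ℕ) : DifferentiableOn ℂ (f (φ n)) (Metric.closedBall z₀ r) :=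
    (hol _ (hf _)).mono hballD
  refine ⟨φ, hφ, ?_⟩
  rcases uniformCauchySeqOn_or_tendstoInftyUniformlyOn (isCompact_sphere z₀ r)
    (isPreconnected_sphere (by simp) z₀ r) hloc with hc | hi
  · exact Or.inl (exists_tendstoLocallyUniformlyOn_ball hr hdiff hc)
  · have := tendstoInftyUniformlyOn_closedBall hr hdiff (fun n => homit _ (hf _)) hi
    exact Or.inr fun M K hK _ => this.mono (hK.trans Metric.ball_subset_closedBall) M
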